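/- Let P_{Y|X} be a Markov kernel from ℝ^n to ℝ^m, let P_X be a probability measure on ℝ^n, let P_Y be the marginal of P_{Y|X} under P_X, let Q be a σ-finite measure on ℝ^m, and let λ ≠ 0. Assume that for all x ∈ ℝ^n: P_Y ≪ Q and P_{Y|X=x} ≪ Q; P_Y and P_{Y|X=x} are mutually absolutely continuous; K_{h,Q,x}(−λ) is finite; h(x,·) is integrable with respect to P_Y, P_{Y|X=x}, and the (h,Q,λ)-Gibbs probability measure P^{(h,Q,λ)}_{Y|X=x}; D(P_Y‖Q) and D(P_{Y|X=x}‖Q) are finite; and all integrals below exist and are finite. Then Ḡ_h(P_Y, P_{Y|X}, P_X) = (1/λ) ( I(P_{Y|X}; P_X) + L(P_{Y|X}; P_X) + ∫∫ log( dP_{Y|X=x}/dP^{(h,Q,λ)}_{Y|X=x} (y) ) dP_Y(y) dP_X(x) − ∫∫ log( dP_{Y|X=x}/dP^{(h,Q,λ)}_{Y|X=x} (y) ) dP_{Y|X=x}(y) dP_X(x) ). -/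

import Mathlib

open MeasureTheory Real ProbabilityTheory

/-- Real-valued relative entropy (KL divergence) `D(μ‖ν) = ∫ log (dμ/dν) dμ`. -/
noncomputable def klDivR {α : Type*} [MeasurableSpace α] (μ ν : Measure α) : ℝ :=
  ∫ y, Real.log ((μ.rnDeriv ν y).toReal) ∂μ

/-- `cgfK h Q x t = K_{h,Q,x}(t) = log ∫ exp (t * h x y) dQ(y)`. -/
noncomputable def cgfK {n m : ℕ} (h : (Fin n → ℝ) → (Fin m → ℝ) → ℝ)
    (Q : Measure (Fin m → ℝ)) (x : Fin n → ℝ) (t : ℝ) : ℝ :=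
  Real.log (∫ y, Real.exp (t * h x y) ∂Q)

/-- The `(h,Q,λ)`-Gibbs probability measure `P^{(h,Q,λ)}_{Y|X=x}`, which has density
`exp (-λ * h(x,y) - K_{h,Q,x}(-λ))` with respect to `Q`. -/
noncomputable def gibbs {n m : ℕ} (h : (Fin n → ℝ) → (Fin m → ℝ) → ℝ)
    (Q : Measure (Fin m → ℝ)) (lam : ℝ) (x : Fin n → ℝ) : Measure (Fin m → ℝ) :=
  Q.withDensity fun y => ENNReal.ofReal (Real.exp (-lam * h x y - cgfK h Q x (-lam)))

lemma integrable_fun_sub {α : Type*} [MeasurableSpace α] {μ : Measure α} {f g : α → ℝ}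
    (hf : Integrable f μ) (hg : Integrable g μ) : Integrable (fun y => f y - g y) μ :=
  hf.sub hg

/-- A density is almost surely positive with respect to the measure it defines. -/
lemma toReal_rnDeriv_pos {α : Type*} [MeasurableSpace α] {μ ν : Measure α} [SigmaFinite μ]
    [SigmaFinite ν] (hμν : μ ≪ ν) : ∀ᵐ y ∂μ, 0 < (μ.rnDeriv ν y).toReal := by
  filter_upwards [Measure.rnDeriv_pos hμν, hμν.ae_le (Measure.rnDeriv_lt_top μ ν)] with y h1 h2
  exact ENNReal.toReal_pos h1.ne' h2.ne

/-- Chain rule for log-likelihood ratios. -/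
lemma llr_eq_llr_add_llr {α : Type*} [MeasurableSpace α] {μ ν ρ : Measure α} [SigmaFinite μ]
    [SigmaFinite ν] [SigmaFinite ρ] (hμν : μ ≪ ν) (hνρ : ν ≪ ρ) :
    llr μ ρ =ᵐ[μ] fun y => llr μ ν y + llr ν ρ y := by
  have hμρ := hμν.trans hνρ
  filter_upwards [hμρ.ae_le (Measure.rnDeriv_mul_rnDeriv (κ := ρ) hμν),
    toReal_rnDeriv_pos hμν, hμν.ae_le (toReal_rnDeriv_pos hνρ)] with y h1 h2 h3
  simp only [llr, ← h1, Pi.mul_apply, ENNReal.toReal_mul]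
  exact Real.log_mul h2.ne' h3.ne'

lemma gibbs_eq_tilted {n m : ℕ} (h : (Fin n → ℝ) → (Fin m → ℝ) → ℝ)
    (Q : Measure (Fin m → ℝ)) (lam : ℝ) (x : Fin n → ℝ)
    (hpos : 0 < ∫ y, Real.exp (-lam * h x y) ∂Q) :
    gibbs h Q lam x = Q.tilted fun y => -lam * h x y := by
  simp only [gibbs, Measure.tilted, cgfK, Real.exp_sub, Real.exp_log hpos]

/-- The Jeffreys divergence of `μ` and `ν`, corrected by the change of `llr μ ρ`, reduces to the
change of `llr ν ρ`. -/
lemma klDivR_add_klDivR_add_integral_llr_sub {α : Type*} [MeasurableSpace α] {μ ν ρ : Measure α}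
    [SigmaFinite μ] [SigmaFinite ν] [SigmaFinite ρ] (hμν : μ ≪ ν) (hνμ : ν ≪ μ) (hνρ : ν ≪ ρ)
    (hνρ_int : Integrable (llr ν ρ) ν) (hμρ_int : Integrable (llr μ ρ) μ)
    (hμν_int : Integrable (llr μ ν) μ) (hνμ_int : Integrable (llr ν μ) ν) :
    klDivR μ ν + klDivR ν μ + ((∫ y, llr μ ρ y ∂ν) - ∫ y, llr μ ρ y ∂μ)
      = (∫ y, llr ν ρ y ∂ν) - ∫ y, llr ν ρ y ∂μ := by
  have e1 : llr ν ρ =ᵐ[μ] fun y => llr μ ρ y - llr μ ν y := by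
    filter_upwards [llr_eq_llr_add_llr hμν hνρ] with y hy
    linarith
  have e2 : llr μ ρ =ᵐ[ν] fun y => llr ν ρ y - llr ν μ y := by
    filter_upwards [llr_eq_llr_add_llr hνμ (hμν.trans hνρ)] with y hy
    linarith
  rw [integral_congr_ae e1, integral_congr_ae e2, integral_sub hμρ_int hμν_int,
    integral_sub hνρ_int hνμ_int]
  simp only [klDivR, llr]
  ring

/-- The `llr` against a Gibbs measure changes between two measures as the `llr` against the
reference measure, up to the variation of the energy. -/
lemma integral_llr_gibbs_sub {n m : ℕ} (h : (Fin n → ℝ) → (Fin m → ℝ) → ℝ)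
    {μ ν Q : Measure (Fin m → ℝ)} [IsProbabilityMeasure μ] [IsProbabilityMeasure ν] [SigmaFinite Q]
    (lam : ℝ) (x : Fin n → ℝ) (hμQ : μ ≪ Q) (hνμ : ν ≪ μ)
    (hexp : Integrable (fun y => Real.exp (-lam * h x y)) Q)
    (hpos : 0 < ∫ y, Real.exp (-lam * h x y) ∂Q)
    (hμ : Integrable (h x) μ) (hν : Integrable (h x) ν)
    (hlogμ : Integrable (llr μ (gibbs h Q lam x)) μ)
    (hlogν : Integrable (llr μ (gibbs h Q lam x)) ν) :
    (∫ y, llr μ (gibbs h Q lam x) y ∂ν) - ∫ y, llr μ (gibbs h Q lam x) y ∂μ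
      = lam * ((∫ y, h x y ∂ν) - ∫ y, h x y ∂μ)
        + ((∫ y, llr μ Q y ∂ν) - ∫ y, llr μ Q y ∂μ) := by
  have e : llr μ Q =ᵐ[μ] fun y =>
      llr μ (gibbs h Q lam x) y - lam * h x y - cgfK h Q x (-lam) := by
    rw [gibbs_eq_tilted h Q lam x hpos]
    filter_upwards [llr_tilted_right hμQ hexp] with y hy
    rw [hy, cgfK]
    ring
  rw [integral_congr_ae e, integral_congr_ae (hνμ.ae_le e),
    integral_sub (integrable_fun_sub hlogμ (hμ.const_mul lam)) (integrable_const _),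
    integral_sub hlogμ (hμ.const_mul lam),
    integral_sub (integrable_fun_sub hlogν (hν.const_mul lam)) (integrable_const _),
    integral_sub hlogν (hν.const_mul lam)]
  simp only [integral_const, probReal_univ, integral_const_mul]
  ring

theorem stmt13 {n m : ℕ} (h : (Fin n → ℝ) → (Fin m → ℝ) → ℝ)
    (hMeas : Measurable (Function.uncurry h))
    (κ : Kernel (Fin n → ℝ) (Fin m → ℝ)) [IsMarkovKernel κ]
    (PX : Measure (Fin n → ℝ)) [IsProbabilityMeasure PX]
    (PY : Measure (Fin m → ℝ)) (hPY : PY = PX.bind (fun x => κ x))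
    (Q : Measure (Fin m → ℝ)) [SigmaFinite Q]
    (lam : ℝ) (hlam : lam ≠ 0)
    (hacY : PY ≪ Q) (hacK : ∀ x, κ x ≪ Q)
    (hmut1 : ∀ x, PY ≪ κ x) (hmut2 : ∀ x, κ x ≪ PY)
    (hKint : ∀ x, Integrable (fun y => Real.exp (-lam * h x y)) Q)
    (hKpos : ∀ x, 0 < ∫ y, Real.exp (-lam * h x y) ∂Q)
    (hIntY : ∀ x, Integrable (h x) PY) (hIntK : ∀ x, Integrable (h x) (κ x))
    (hGint : ∀ x, Integrable (h x) (gibbs h Q lam x))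
    (hKLYQ : Integrable (fun y => Real.log ((PY.rnDeriv Q y).toReal)) PY)
    (hKLKQ : ∀ x, Integrable (fun y => Real.log (((κ x).rnDeriv Q y).toReal)) (κ x))
    (hI : ∀ x, Integrable (fun y => Real.log (((κ x).rnDeriv PY y).toReal)) (κ x))
    (hL : ∀ x, Integrable (fun y => Real.log ((PY.rnDeriv (κ x) y).toReal)) PY)
    (hlogY : ∀ x, Integrable (fun y => Real.log (((κ x).rnDeriv (gibbs h Q lam x) y).toReal)) PY)
    (hlogK : ∀ x, Integrable (fun y => Real.log (((κ x).rnDeriv (gibbs h Q lam x) y).toReal)) (κ x))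
    (hOuterG : Integrable (fun x => (∫ y, h x y ∂PY) - ∫ y, h x y ∂(κ x)) PX)
    (hOuterI : Integrable (fun x => klDivR (κ x) PY) PX)
    (hOuterL : Integrable (fun x => klDivR PY (κ x)) PX)
    (hOuterY : Integrable (fun x => ∫ y, Real.log (((κ x).rnDeriv (gibbs h Q lam x) y).toReal) ∂PY) PX)
    (hOuterK : Integrable (fun x => ∫ y, Real.log (((κ x).rnDeriv (gibbs h Q lam x) y).toReal) ∂(κ x)) PX) :
    ∫ x, ((∫ y, h x y ∂PY) - ∫ y, h x y ∂(κ x)) ∂PX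
      = (1 / lam) * ((∫ x, klDivR (κ x) PY ∂PX) + (∫ x, klDivR PY (κ x) ∂PX)
          + (∫ x, ∫ y, Real.log (((κ x).rnDeriv (gibbs h Q lam x) y).toReal) ∂PY ∂PX)
          - ∫ x, ∫ y, Real.log (((κ x).rnDeriv (gibbs h Q lam x) y).toReal) ∂(κ x) ∂PX) := by
  have hPYprob : IsProbabilityMeasure PY := by
    rw [hPY]
    infer_instance
  have key : ∀ x, (∫ y, h x y ∂PY) - ∫ y, h x y ∂(κ x)
      = (1 / lam) * (klDivR (κ x) PY + klDivR PY (κ x)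
        + (∫ y, Real.log (((κ x).rnDeriv (gibbs h Q lam x) y).toReal) ∂PY)
        - (∫ y, Real.log (((κ x).rnDeriv (gibbs h Q lam x) y).toReal) ∂(κ x))
        - ((∫ y, llr PY Q y ∂PY) - ∫ y, llr PY Q y ∂(κ x))) := by
    intro x
    have e1 := klDivR_add_klDivR_add_integral_llr_sub (hmut2 x) (hmut1 x) hacY hKLYQ (hKLKQ x)
      (hI x) (hL x)
    have e2 := integral_llr_gibbs_sub h lam x (hacK x) (hmut1 x) (hKint x) (hKpos x) (hIntK x)
      (hIntY x) (hlogK x) (hlogY x)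
    rw [one_div, eq_inv_mul_iff_mul_eq₀ hlam, ← e1]
    simp only [llr] at e2 ⊢
    linarith
  have hcomp : PX.bind (fun x => κ x) = (κ ∘ₖ Kernel.const Unit PX) () :=
    Measure.comp_eq_comp_const_apply
  have hbind_int : Integrable (llr PY Q) (PX.bind (fun x => κ x)) := hPY ▸ hKLYQ
  have hinner : Integrable (fun x => ∫ y, llr PY Q y ∂(κ x)) PX := by
    rw [hcomp] at hbind_int
    exact hbind_int.integral_comp
  have hbind : ∫ x, ∫ y, llr PY Q y ∂(κ x) ∂PX = ∫ y, llr PY Q y ∂PY := by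
    have hbc := hcomp ▸ hbind_int
    rw [← Kernel.const_apply PX (), ← Kernel.integral_comp hbc, ← hcomp, ← hPY]
  simp_rw [key]
  rw [integral_const_mul, integral_sub (integrable_fun_sub ((hOuterI.fun_add hOuterL).fun_add hOuterY) hOuterK)
      (integrable_fun_sub (integrable_const _) hinner),
    integral_sub ((hOuterI.fun_add hOuterL).fun_add hOuterY) hOuterK,
    integral_add (hOuterI.fun_add hOuterL) hOuterY, integral_add hOuterI hOuterL,
    integral_sub (integrable_const _) hinner, hbind]
  simp
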